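/- For every natural number n ≥ 1, the number of binary trees with n internal nodes (equivalently, full binary trees with n+1 leaves) equals the number of torsion pairs in the interval model I_{n-1}; in particular there exists a bijection between the set of binary trees with n+1 leaves and the set of torsion classes of type A_{n-1}. -/

import Mathlib

/-- The interval model of type `A n`: pairs `(a, b)` with `1 ≤ a ≤ b ≤ n`. -/
def Ivl (n : ℕ) : Set (ℕ × ℕ) := {p | 1 ≤ p.1 ∧ p.1 ≤ p.2 ∧ p.2 ≤ n}

/-- `homA x y` encodes nonvanishing of `Hom` between the interval modules
`x = (a, b)` and `y = (c, d)`: it holds iff `c ≤ a ∧ a ≤ d ∧ d ≤ b`. -/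
def homA (x y : ℕ × ℕ) : Prop := y.1 ≤ x.1 ∧ x.1 ≤ y.2 ∧ y.2 ≤ x.2

/-- A torsion pair in the interval model `I n`: two subsets which are each other's
hom-orthogonal complements inside `I n`. -/
def IsTorsionPair (n : ℕ) (G F : Set (ℕ × ℕ)) : Prop :=
  G = {x ∈ Ivl n | ∀ y ∈ F, ¬ homA x y} ∧
  F = {y ∈ Ivl n | ∀ x ∈ G, ¬ homA x y}

/-- A torsion class is the first component of a torsion pair. -/
def IsTorsionClass (n : ℕ) (G : Set (ℕ × ℕ)) : Prop :=
  ∃ F, IsTorsionPair n G F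

/-- Bracket vectors (as functions on `ℕ`, equal to the identity from `n` on). -/
structure BV (n : ℕ) (h : ℕ → ℕ) : Prop where
  le : ∀ i, i ≤ h i
  lt : ∀ i, i < n → h i < n
  out : ∀ i, n ≤ i → h i = i
  nest : ∀ i j, i ≤ j → j ≤ h i → h j ≤ h i

/-- The bracket vector of a tree. -/
def bvec : BinaryTree Unit → ℕ → ℕ
  | .nil, i => i
  | .node _ l r, i =>
    if i < l.numNodes then bvec l i
    else if i = l.numNodes then l.numNodes + r.numNodes
    else l.numNodes + 1 + bvec r (i - (l.numNodes + 1))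

theorem bvec_left (u : Unit) (l r : BinaryTree Unit) (i : ℕ) (hi : i < l.numNodes) :
    bvec (.node u l r) i = bvec l i := by
  simp [bvec, hi]

theorem bvec_mid (u : Unit) (l r : BinaryTree Unit) :
    bvec (.node u l r) l.numNodes = l.numNodes + r.numNodes := by
  simp [bvec]

theorem bvec_right (u : Unit) (l r : BinaryTree Unit) (i : ℕ) :
    bvec (.node u l r) (l.numNodes + 1 + i) = l.numNodes + 1 + bvec r i := by
  have h1 : ¬ (l.numNodes + 1 + i < l.numNodes) := by omega
  have h2 : ¬ (l.numNodes + 1 + i = l.numNodes) := by omega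
  simp only [bvec, h1, h2, if_false]
  congr 2
  omega

theorem bvec_bv (t : BinaryTree Unit) : BV t.numNodes (bvec t) := by
  induction t with
  | nil => exact ⟨fun i => le_rfl, fun i hi => by simp [BinaryTree.numNodes] at hi, fun i _ => rfl,
      fun i j _ h => h⟩
  | node u l r ihl ihr =>
    have cases : ∀ i, i < l.numNodes ∨ i = l.numNodes ∨ ∃ k, i = l.numNodes + 1 + k := by
      intro i
      rcases lt_trichotomy i l.numNodes with h | h | h
      · exact Or.inl h
      · exact Or.inr (Or.inl h)
      · exact Or.inr (Or.inr ⟨i - (l.numNodes + 1), by omega⟩)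
    refine ⟨?_, ?_, ?_, ?_⟩
    · intro i
      rcases cases i with h | rfl | ⟨k, rfl⟩
      · rw [bvec_left _ _ _ _ h]; exact ihl.le i
      · rw [bvec_mid]; omega
      · rw [bvec_right]; have := ihr.le k; omega
    · intro i hi
      simp only [BinaryTree.numNodes] at hi ⊢
      rcases cases i with h | rfl | ⟨k, rfl⟩
      · rw [bvec_left _ _ _ _ h]; have := ihl.lt i h; omega
      · rw [bvec_mid]; omega
      · rw [bvec_right]; have := ihr.lt k (by omega); omega
    · intro i hi
      simp only [BinaryTree.numNodes] at hi
      rcases cases i with h | rfl | ⟨k, rfl⟩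
      · omega
      · omega
      · rw [bvec_right, ihr.out k (by omega)]
    · intro i j hij hj
      rcases cases i with h | rfl | ⟨k, rfl⟩
      · rw [bvec_left _ _ _ _ h] at hj ⊢
        have h1 := ihl.lt i h
        rw [bvec_left _ _ _ _ (by omega)]
        exact ihl.nest i j hij hj
      · rw [bvec_mid] at hj ⊢
        rcases cases j with h | rfl | ⟨k, rfl⟩
        · omega
        · rw [bvec_mid]
        · rw [bvec_right]
          have := ihr.lt k (by omega)
          omega
      · rw [bvec_right] at hj ⊢
        obtain ⟨k', rfl⟩ : ∃ k', j = l.numNodes + 1 + k' := ⟨j - (l.numNodes + 1), by omega⟩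
        rw [bvec_right]
        have := ihr.nest k k' (by omega) (by omega)
        omega

theorem bvec_inj (t t' : BinaryTree Unit) (hn : t.numNodes = t'.numNodes) (h : bvec t = bvec t') :
    t = t' := by
  induction t generalizing t' with
  | nil =>
    cases t' with
    | nil => rfl
    | node u l r => simp [BinaryTree.numNodes] at hn
  | node u l r ihl ihr =>
    cases t' with
    | nil => simp [BinaryTree.numNodes] at hn
    | node u' l' r' =>
      simp only [BinaryTree.numNodes] at hn
      have key : l.numNodes = l'.numNodes := by
        rcases lt_trichotomy l.numNodes l'.numNodes with hl | hl | hl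
        · have h1 := congrFun h l.numNodes
          rw [bvec_mid, bvec_left _ _ _ _ hl] at h1
          have := (bvec_bv l').lt _ hl
          omega
        · exact hl
        · have h1 := congrFun h l'.numNodes
          rw [bvec_mid, bvec_left _ _ _ _ hl] at h1
          have := (bvec_bv l).lt _ hl
          omega
      have hl : l = l' := by
        apply ihl _ key
        funext i
        by_cases hi : i < l.numNodes
        · have h1 := congrFun h i
          rwa [bvec_left _ _ _ _ hi, bvec_left _ _ _ _ (by omega)] at h1
        · rw [(bvec_bv l).out i (by omega), (bvec_bv l').out i (by omega)]
      have hr : r = r' := by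
        apply ihr _ (by omega)
        funext i
        have h1 := congrFun h (l.numNodes + 1 + i)
        rw [bvec_right, key, bvec_right] at h1
        omega
      subst hl hr
      rfl

theorem bvec_surj (n : ℕ) : ∀ h, BV n h → ∃ t : BinaryTree Unit, t.numNodes = n ∧ bvec t = h := by
  induction n using Nat.strong_induction_on with
  | _ n ih =>
    intro h hh
    rcases Nat.eq_zero_or_pos n with rfl | hpos
    · exact ⟨.nil, rfl, funext fun i => (hh.out i (Nat.zero_le _)).symm⟩
    · have ex : ∃ k, h k = n - 1 := ⟨n - 1, by
        have := hh.le (n - 1); have := hh.lt (n - 1) (by omega); omega⟩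
      classical
      obtain ⟨k, hk, hmin⟩ : ∃ k, h k = n - 1 ∧ ∀ j, j < k → h j ≠ n - 1 :=
        ⟨Nat.find ex, Nat.find_spec ex, fun j hj => Nat.find_min ex hj⟩
      have hkn : k ≤ n - 1 := hk ▸ hh.le k
      have hlow : ∀ j, j < k → h j < k := by
        intro j hj
        by_contra hc
        have h1 := hh.nest j k hj.le (by omega)
        have h2 := hh.lt j (by omega)
        exact hmin j hj (by omega)
      obtain ⟨l, hl, hl'⟩ := ih k (by omega) (fun i => if i < k then h i else i) (by
        refine ⟨?_, ?_, ?_, ?_⟩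
        · intro i
          have := hh.le i
          try dsimp only
          split_ifs <;> omega
        · intro i hi
          simpa [hi] using hlow i hi
        · intro i hi
          simp [hi]
        · intro i j hij hj
          by_cases hi : i < k
          · rw [if_pos hi] at hj ⊢
            have := hlow i hi
            rw [if_pos (by omega)]
            exact hh.nest i j hij hj
          · rw [if_neg hi] at hj ⊢
            rw [if_neg (by omega)]
            exact hj)
      obtain ⟨r, hr, hr'⟩ := ih (n - 1 - k) (by omega) (fun i => h (k + 1 + i) - (k + 1)) (by
        refine ⟨?_, ?_, ?_, ?_⟩
        · intro i
          have := hh.le (k + 1 + i)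
          try dsimp only
          omega
        · intro i hi
          have := hh.lt (k + 1 + i) (by omega)
          try dsimp only
          omega
        · intro i hi
          have := hh.out (k + 1 + i) (by omega)
          try dsimp only
          omega
        · intro i j hij hj
          have := hh.le (k + 1 + i)
          have := hh.nest (k + 1 + i) (k + 1 + j) (by omega) (by omega)
          omega)
      refine ⟨.node () l r, by simp only [BinaryTree.numNodes]; omega, ?_⟩
      funext i
      rcases lt_trichotomy i l.numNodes with hi | hi | hi
      · rw [bvec_left _ _ _ _ hi, hl']
        simp [hl ▸ hi]
      · rw [hi, bvec_mid, hl, hk]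
        omega
      · obtain ⟨j, rfl⟩ : ∃ j, i = l.numNodes + 1 + j := ⟨i - (l.numNodes + 1), by omega⟩
        rw [bvec_right, hr', hl]
        have := hh.le (k + 1 + j)
        try dsimp only
        omega

/-- The set of intervals attached to a bracket vector. -/
def gset (h : ℕ → ℕ) : Set (ℕ × ℕ) := {p | 1 ≤ p.1 ∧ p.1 ≤ p.2 ∧ p.2 ≤ h (p.1 - 1)}

theorem mem_gset (h : ℕ → ℕ) (i b : ℕ) : (i + 1, b) ∈ gset h ↔ i < b ∧ b ≤ h i := by
  simp only [gset, Set.mem_ofPred_eq, Nat.add_sub_cancel]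
  omega

theorem mem_gset_of (h : ℕ → ℕ) (a b : ℕ) :
    (a, b) ∈ gset h ↔ 1 ≤ a ∧ a ≤ b ∧ b ≤ h (a - 1) := Iff.rfl

theorem gset_inj (h h' : ℕ → ℕ) (hh : ∀ i, i ≤ h i) (hh' : ∀ i, i ≤ h' i)
    (e : gset h = gset h') : h = h' := by
  funext i
  have h1 := mem_gset h i (h i)
  have h2 := mem_gset h' i (h i)
  have h3 := mem_gset h i (h' i)
  have h4 := mem_gset h' i (h' i)
  rw [e] at h1 h3
  have := hh i
  have := hh' i
  have h5 := h1.symm.trans h2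
  have h6 := h3.symm.trans h4
  omega

theorem gset_torsion (n : ℕ) (hn : 1 ≤ n) (h : ℕ → ℕ) (hh : BV n h) :
    IsTorsionClass (n - 1) (gset h) := by
  refine ⟨{y ∈ Ivl (n - 1) | ∀ x ∈ gset h, ¬ homA x y}, ?_, rfl⟩
  ext ⟨a, b⟩
  constructor
  · intro hx
    refine ⟨?_, fun y hy => hy.2 _ hx⟩
    obtain ⟨h1, h2, h3⟩ := hx
    dsimp only at h1 h2 h3
    refine ⟨h1, h2, ?_⟩
    try dsimp only
    by_cases ha : a - 1 < n
    · have := hh.lt _ ha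
      omega
    · have := hh.out (a - 1) (by omega)
      omega
  · rintro ⟨⟨h1, h2, h3⟩, hF⟩
    dsimp only at h1 h2 h3
    refine ⟨h1, h2, ?_⟩
    try dsimp only
    by_contra hc
    have hle := hh.le (a - 1)
    refine hF (a, h (a - 1) + 1) ⟨⟨h1, ?_, ?_⟩, ?_⟩ ⟨le_rfl, ?_, ?_⟩
    · dsimp only; omega
    · dsimp only; omega
    · rintro ⟨a', b'⟩ ⟨g1, g2, g3⟩ ⟨f1, f2, f3⟩
      dsimp only at *
      have := hh.nest (a - 1) (a' - 1) (by omega) (by omega)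
      omega
    · dsimp only; omega
    · dsimp only; omega

theorem torsion_gset (n : ℕ) (hn : 1 ≤ n) (G : Set (ℕ × ℕ)) (hG : IsTorsionClass (n - 1) G) :
    ∃ h, BV n h ∧ gset h = G := by
  obtain ⟨F, hG, -⟩ := hG
  have hiv : ∀ a b, (a, b) ∈ G → 1 ≤ a ∧ a ≤ b ∧ b ≤ n - 1 := by
    intro a b hab
    rw [hG] at hab
    exact hab.1
  have hort : ∀ a b c d, (a, b) ∈ G → (c, d) ∈ F → ¬ (c ≤ a ∧ a ≤ d ∧ d ≤ b) := by
    intro a b c d hab hcd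
    rw [hG] at hab
    exact hab.2 _ hcd
  have hmem : ∀ a b, 1 ≤ a → a ≤ b → b ≤ n - 1 →
      (∀ c d, (c, d) ∈ F → ¬ (c ≤ a ∧ a ≤ d ∧ d ≤ b)) → (a, b) ∈ G := by
    intro a b h1 h2 h3 h4
    rw [hG]
    exact ⟨⟨h1, h2, h3⟩, fun y hy => h4 y.1 y.2 hy⟩
  have hdown : ∀ a b d, (a, b) ∈ G → a ≤ d → d ≤ b → (a, d) ∈ G := by
    intro a b d hab had hdb
    have := hiv _ _ hab
    refine hmem _ _ (by omega) had (by omega) fun c e hce hc => ?_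
    exact hort _ _ _ _ hab hce (by omega)
  have hex : ∀ i, ∃ m, i ≤ m ∧ ∀ b, (i + 1, b) ∈ G ↔ i < b ∧ b ≤ m := by
    intro i
    by_cases he : ∃ b, (i + 1, b) ∈ G
    · classical
      obtain ⟨b, hb⟩ := he
      have hbn := hiv _ _ hb
      refine ⟨Nat.findGreatest (fun b => (i + 1, b) ∈ G) (n - 1), ?_, ?_⟩
      · have := Nat.le_findGreatest (P := fun b => (i + 1, b) ∈ G) hbn.2.2 hb
        omega
      · have hs := Nat.findGreatest_spec (P := fun b => (i + 1, b) ∈ G) hbn.2.2 hb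
        intro c
        constructor
        · intro hc
          have hcn := hiv _ _ hc
          exact ⟨by omega, Nat.le_findGreatest hcn.2.2 hc⟩
        · rintro ⟨h1, h2⟩
          exact hdown _ _ _ hs (by omega) h2
    · refine ⟨i, le_rfl, fun b => ⟨fun hb => (he ⟨b, hb⟩).elim, fun hb => by omega⟩⟩
  choose h hle hiff using hex
  have htop : ∀ i, i < h i → (i + 1, h i) ∈ G := fun i hi => (hiff i (h i)).2 ⟨hi, le_rfl⟩
  refine ⟨h, ⟨hle, ?_, ?_, ?_⟩, ?_⟩
  · intro i hi
    by_contra hc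
    have := hiv _ _ (htop i (by omega))
    omega
  · intro i hi
    by_contra hc
    have := hle i
    have := hiv _ _ (htop i (by omega))
    omega
  · intro i j hij hj
    by_contra hc
    have hij' : i ≠ j := by rintro rfl; omega
    have g1 := htop i (by omega)
    have g2 := htop j (by omega)
    have i1 := hiv _ _ g1
    have i2 := hiv _ _ g2
    have g3 : (i + 1, h j) ∈ G := by
      refine hmem _ _ (by omega) (by omega) (by omega) fun c d hcd hc' => ?_
      by_cases hd : d ≤ h i
      · exact hort _ _ _ _ g1 hcd (by omega)
      · exact hort _ _ _ _ g2 hcd (by omega)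
    have := (hiff _ _).1 g3
    omega
  · ext ⟨a, b⟩
    rcases a with _ | i
    · constructor
      · intro hx
        have := hx.1
        simp at this
      · intro hx
        have := hiv _ _ hx
        omega
    · rw [mem_gset, hiff]

/-- The map from trees to torsion classes. -/
def treeMap (n : ℕ) (hn : 1 ≤ n) (t : {t : BinaryTree Unit // t ∈ BinaryTree.treesOfNumNodesEq n}) :
    {G : Set (ℕ × ℕ) // IsTorsionClass (n - 1) G} :=
  ⟨gset (bvec t.1), gset_torsion n hn _ (by
    have := bvec_bv t.1
    rwa [BinaryTree.mem_treesOfNumNodesEq.1 t.2] at this)⟩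

theorem treeMap_bij (n : ℕ) (hn : 1 ≤ n) : Function.Bijective (treeMap n hn) := by
  constructor
  · rintro ⟨t, ht⟩ ⟨t', ht'⟩ e
    have e' : gset (bvec t) = gset (bvec t') := congrArg Subtype.val e
    have hb := gset_inj _ _ (bvec_bv t).le (bvec_bv t').le e'
    apply Subtype.ext
    rw [BinaryTree.mem_treesOfNumNodesEq] at ht ht'
    exact bvec_inj t t' (ht.trans ht'.symm) hb
  · rintro ⟨G, hG⟩
    obtain ⟨h, hh, rfl⟩ := torsion_gset n hn G hG
    obtain ⟨t, ht, rfl⟩ := bvec_surj n h hh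
    exact ⟨⟨t, BinaryTree.mem_treesOfNumNodesEq.2 ht⟩, rfl⟩

/-- Torsion pairs correspond to torsion classes. -/
theorem pairs_bij (m : ℕ) : Function.Bijective
    (fun p : {p : Set (ℕ × ℕ) × Set (ℕ × ℕ) // IsTorsionPair m p.1 p.2} =>
      (⟨p.1.1, p.1.2, p.2⟩ : {G : Set (ℕ × ℕ) // IsTorsionClass m G})) := by
  constructor
  · rintro ⟨⟨G, F⟩, h⟩ ⟨⟨G', F'⟩, h'⟩ e
    have e' : G = G' := congrArg Subtype.val e
    subst e'
    have : F = F' := h.2.trans h'.2.symm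
    subst this
    rfl
  · rintro ⟨G, F, h⟩
    exact ⟨⟨(G, F), h⟩, rfl⟩

/-- The number of binary trees with `n` internal nodes (full binary trees with `n+1`
leaves) equals the number of torsion pairs in the interval model `I (n-1)`; in
particular, there is a bijection between binary trees with `n+1` leaves and torsion
classes of type `A (n-1)`. -/
theorem card_binaryTrees_eq_card_torsionPairs (n : ℕ) (hn : 1 ≤ n) :
    (Tree.treesOfNumNodesEq n).card =
      Nat.card {p : Set (ℕ × ℕ) × Set (ℕ × ℕ) // IsTorsionPair (n - 1) p.1 p.2} ∧
    Nonempty ({t : Tree Unit // t ∈ Tree.treesOfNumNodesEq n} ≃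
      {G : Set (ℕ × ℕ) // IsTorsionClass (n - 1) G}) := by
  refine ⟨?_, ⟨Equiv.ofBijective _ (treeMap_bij n hn)⟩⟩
  rw [Nat.card_congr (Equiv.ofBijective _ (pairs_bij (n - 1))),
    ← Nat.card_congr (Equiv.ofBijective _ (treeMap_bij n hn))]
  rw [Nat.card_eq_fintype_card]
  exact (Fintype.card_coe (BinaryTree.treesOfNumNodesEq n)).symm
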